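/- The 3-sphere (10₍₃₃,₃₅₎) with facet list F0={1,4,7,9}, F1={2,4,7,9}, F2={0,2,4,5,8}, F3={0,2,4,6,9}, F4={1,3,6,7,8}, F5={1,3,4,6,9}, F6={0,2,5,7,9}, F7={1,3,5,7,9}, F8={0,1,4,6,8}, F9={1,2,4,7,8}, F10={2,3,5,7,8}, F11={0,3,5,6,8,9} (subsets of Fin 10) has no polytopal realization; i.e., there is no injective v : Fin 10 → ℝ⁴ such that every v j is an extreme point of P = convexHull ℝ (Set.range v) and the set of facets (3-dimensional proper faces) of P equals { convexHull ℝ (v '' F_i) : 0 ≤ i ≤ 11 }. -/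

import Mathlib

open Module

/-- The facet list of the 3-sphere `(10₍₃₃,₃₅₎)`. -/
def facets : Fin 12 → Set (Fin 10) :=
  ![{1,4,7,9}, {2,4,7,9}, {0,2,4,5,8}, {0,2,4,6,9}, {1,3,6,7,8},
    {1,3,4,6,9}, {0,2,5,7,9}, {1,3,5,7,9}, {0,1,4,6,8}, {1,2,4,7,8},
    {2,3,5,7,8}, {0,3,5,6,8,9}]

/-- Sign data of the facets: supporting functionals. -/
lemma facet_functional (v : Fin 10 → EuclideanSpace ℝ (Fin 4))
    (hinj : Function.Injective v)
    (hext : ∀ j, v j ∈ convexHull ℝ (Set.range v) ∧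
        v j ∉ convexHull ℝ (convexHull ℝ (Set.range v) \ {v j}))
    (S : Set (Fin 10)) (j0 : Fin 10) (hj0 : j0 ∈ S)
    (he : IsExposed ℝ (convexHull ℝ (Set.range v)) (convexHull ℝ (v '' S))) :
    ∃ (l : EuclideanSpace ℝ (Fin 4) →L[ℝ] ℝ) (c : ℝ),
      (∀ j ∈ S, c - l (v j) = 0) ∧ (∀ j, j ∉ S → 0 < c - l (v j)) := by
  have hm0 : v j0 ∈ convexHull ℝ (v '' S) := subset_convexHull ℝ _ ⟨j0, hj0, rfl⟩
  obtain ⟨l, hl⟩ := he ⟨_, hm0⟩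
  have hmem : ∀ j, v j ∈ convexHull ℝ (Set.range v) := fun j => (hext j).1
  rw [hl] at hm0
  refine ⟨l, l (v j0), fun j hj => ?_, fun j hj => ?_⟩
  · have hm : v j ∈ convexHull ℝ (v '' S) := subset_convexHull ℝ _ ⟨j, hj, rfl⟩
    rw [hl] at hm
    have h1 := hm.2 _ (hmem j0)
    have h2 := hm0.2 _ (hmem j)
    linarith
  · have h2 := hm0.2 _ (hmem j)
    rcases h2.lt_or_eq with h | h
    · linarith
    · exfalso
      have hm : v j ∈ convexHull ℝ (v '' S) := by
        rw [hl]
        exact ⟨hmem j, fun y hy => by rw [h]; exact hm0.2 y hy⟩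
      refine (hext j).2 (convexHull_mono ?_ hm)
      rintro _ ⟨k, hk, rfl⟩
      refine ⟨hmem k, fun hkj => hj ?_⟩
      rw [← hinj hkj]
      exact hk

/-- Any six points satisfy a nontrivial affine relation. -/
lemma exists_dep (v : Fin 10 → EuclideanSpace ℝ (Fin 4)) (a : Fin 6 → Fin 10) :
    ∃ w : Fin 6 → ℝ, w ≠ 0 ∧
      ∀ (l : EuclideanSpace ℝ (Fin 4) →L[ℝ] ℝ) (c : ℝ),
        ∑ k, w k * (c - l (v (a k))) = 0 := by
  let f : (Fin 6 → ℝ) →ₗ[ℝ] (EuclideanSpace ℝ (Fin 4) × ℝ) :=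
    Fintype.linearCombination ℝ (fun k => (v (a k), (1 : ℝ)))
  have hk : LinearMap.ker f ≠ ⊥ := by
    apply LinearMap.ker_ne_bot_of_finrank_lt
    simp
  obtain ⟨w, hw, hw0⟩ := (Submodule.ne_bot_iff _).1 hk
  refine ⟨w, hw0, fun l c => ?_⟩
  have h : f w = 0 := hw
  simp only [f, Fintype.linearCombination_apply] at h
  have h1 : ∑ k, w k • v (a k) = 0 := by
    simpa [Prod.fst_sum] using congrArg Prod.fst h
  have h2 : ∑ k, w k = 0 := by
    simpa [Prod.snd_sum] using congrArg Prod.snd h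
  have h3 : ∑ k, w k * l (v (a k)) = 0 := by
    simpa [map_sum] using congrArg l h1
  simp only [mul_sub, Finset.sum_sub_distrib, ← Finset.sum_mul, h2, h3]
  simp

/-- Normal form of a relation: the last point in terms of the first five. -/
lemma exists_comb (s : Fin 12 → Fin 10 → ℝ)
    (hdep : ∀ a : Fin 6 → Fin 10, ∃ w : Fin 6 → ℝ, w ≠ 0 ∧ ∀ i, ∑ k, w k * s i (a k) = 0)
    (a b c d e x : Fin 10)
    (hind : ∀ p q r t u : ℝ,
      (∀ i, p * s i a + q * s i b + r * s i c + t * s i d + u * s i e = 0) →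
      p = 0 ∧ q = 0 ∧ r = 0 ∧ t = 0 ∧ u = 0) :
    ∃ p q r t u : ℝ, ∀ i,
      s i x = p * s i a + q * s i b + r * s i c + t * s i d + u * s i e := by
  obtain ⟨w, hw0, hw⟩ := hdep ![a, b, c, d, e, x]
  simp only [Fin.sum_univ_six] at hw
  have hw' : ∀ i, w 0 * s i a + w 1 * s i b + w 2 * s i c + w 3 * s i d + w 4 * s i e
      + w 5 * s i x = 0 := hw
  have h5 : w 5 ≠ 0 := by
    intro h
    have := hind (w 0) (w 1) (w 2) (w 3) (w 4) (fun i => by simpa [h] using hw' i)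
    obtain ⟨h0, h1, h2, h3, h4⟩ := this
    apply hw0
    funext k
    fin_cases k <;> assumption
  refine ⟨-w 0 / w 5, -w 1 / w 5, -w 2 / w 5, -w 3 / w 5, -w 4 / w 5, fun i => ?_⟩
  have := hw' i
  field_simp
  linarith

set_option linter.unusedSimpArgs false in
set_option maxHeartbeats 2000000 in
/-- There is no slack matrix of rank at most five with the given support. -/
lemma no_slack (s : Fin 12 → Fin 10 → ℝ)
    (hdep : ∀ a : Fin 6 → Fin 10, ∃ w : Fin 6 → ℝ, w ≠ 0 ∧ ∀ i, ∑ k, w k * s i (a k) = 0)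
    (hz : ∀ i j, j ∈ facets i → s i j = 0)
    (hp : ∀ i j, j ∉ facets i → 0 < s i j) : False := by
  have z_0_1 : s 0 1 = 0 := hz _ _ (by simp [facets])
  have z_0_4 : s 0 4 = 0 := hz _ _ (by simp [facets])
  have z_0_7 : s 0 7 = 0 := hz _ _ (by simp [facets])
  have z_0_9 : s 0 9 = 0 := hz _ _ (by simp [facets])
  have z_2_0 : s 2 0 = 0 := hz _ _ (by simp [facets])
  have z_2_2 : s 2 2 = 0 := hz _ _ (by simp [facets])
  have z_2_4 : s 2 4 = 0 := hz _ _ (by simp [facets])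
  have z_2_5 : s 2 5 = 0 := hz _ _ (by simp [facets])
  have z_2_8 : s 2 8 = 0 := hz _ _ (by simp [facets])
  have z_3_0 : s 3 0 = 0 := hz _ _ (by simp [facets])
  have z_3_2 : s 3 2 = 0 := hz _ _ (by simp [facets])
  have z_3_4 : s 3 4 = 0 := hz _ _ (by simp [facets])
  have z_4_1 : s 4 1 = 0 := hz _ _ (by simp [facets])
  have z_4_3 : s 4 3 = 0 := hz _ _ (by simp [facets])
  have z_4_7 : s 4 7 = 0 := hz _ _ (by simp [facets])
  have z_5_1 : s 5 1 = 0 := hz _ _ (by simp [facets])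
  have z_5_3 : s 5 3 = 0 := hz _ _ (by simp [facets])
  have z_5_4 : s 5 4 = 0 := hz _ _ (by simp [facets])
  have z_5_9 : s 5 9 = 0 := hz _ _ (by simp [facets])
  have z_7_1 : s 7 1 = 0 := hz _ _ (by simp [facets])
  have z_7_3 : s 7 3 = 0 := hz _ _ (by simp [facets])
  have z_7_5 : s 7 5 = 0 := hz _ _ (by simp [facets])
  have z_7_7 : s 7 7 = 0 := hz _ _ (by simp [facets])
  have z_7_9 : s 7 9 = 0 := hz _ _ (by simp [facets])
  have z_8_0 : s 8 0 = 0 := hz _ _ (by simp [facets])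
  have z_8_1 : s 8 1 = 0 := hz _ _ (by simp [facets])
  have z_8_4 : s 8 4 = 0 := hz _ _ (by simp [facets])
  have z_8_8 : s 8 8 = 0 := hz _ _ (by simp [facets])
  have z_9_1 : s 9 1 = 0 := hz _ _ (by simp [facets])
  have z_9_2 : s 9 2 = 0 := hz _ _ (by simp [facets])
  have z_9_4 : s 9 4 = 0 := hz _ _ (by simp [facets])
  have z_9_7 : s 9 7 = 0 := hz _ _ (by simp [facets])
  have z_9_8 : s 9 8 = 0 := hz _ _ (by simp [facets])
  have p_0_0 : 0 < s 0 0 := hp _ _ (by simp [facets])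
  have p_0_2 : 0 < s 0 2 := hp _ _ (by simp [facets])
  have p_0_3 : 0 < s 0 3 := hp _ _ (by simp [facets])
  have p_0_8 : 0 < s 0 8 := hp _ _ (by simp [facets])
  have p_2_1 : 0 < s 2 1 := hp _ _ (by simp [facets])
  have p_3_1 : 0 < s 3 1 := hp _ _ (by simp [facets])
  have p_3_5 : 0 < s 3 5 := hp _ _ (by simp [facets])
  have p_3_8 : 0 < s 3 8 := hp _ _ (by simp [facets])
  have p_4_5 : 0 < s 4 5 := hp _ _ (by simp [facets])
  have p_4_9 : 0 < s 4 9 := hp _ _ (by simp [facets])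
  have p_5_0 : 0 < s 5 0 := hp _ _ (by simp [facets])
  have p_5_7 : 0 < s 5 7 := hp _ _ (by simp [facets])
  have p_7_4 : 0 < s 7 4 := hp _ _ (by simp [facets])
  have p_8_2 : 0 < s 8 2 := hp _ _ (by simp [facets])
  have p_8_3 : 0 < s 8 3 := hp _ _ (by simp [facets])
  have p_8_5 : 0 < s 8 5 := hp _ _ (by simp [facets])
  have p_8_7 : 0 < s 8 7 := hp _ _ (by simp [facets])
  have p_8_9 : 0 < s 8 9 := hp _ _ (by simp [facets])
  have p_9_0 : 0 < s 9 0 := hp _ _ (by simp [facets])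
  have p_9_3 : 0 < s 9 3 := hp _ _ (by simp [facets])
  have p_9_5 : 0 < s 9 5 := hp _ _ (by simp [facets])
  have p_9_9 : 0 < s 9 9 := hp _ _ (by simp [facets])
  have ind1 : ∀ p q r t u : ℝ,
      (∀ i, p * s i 1 + q * s i 4 + r * s i 7 + t * s i 9 + u * s i 3 = 0) →
      p = 0 ∧ q = 0 ∧ r = 0 ∧ t = 0 ∧ u = 0 := by
    intro p q r t u h
    have e0 := h 0
    have e5 := h 5
    have e9 := h 9
    have e7 := h 7
    have e2 := h 2
    simp only [z_0_1, z_0_4, z_0_7, z_0_9, z_2_0, z_2_2, z_2_4, z_2_5, z_2_8, z_3_0, z_3_2, z_3_4, z_4_1, z_4_3, z_4_7, z_5_1, z_5_3, z_5_4, z_5_9, z_7_1, z_7_3, z_7_5, z_7_7, z_7_9, z_8_0, z_8_1, z_8_4, z_8_8, z_9_1, z_9_2, z_9_4, z_9_7, z_9_8, mul_zero, add_zero, zero_add] at e0 e5 e9 e7 e2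
    have hu : u = 0 := by simpa [p_0_3.ne'] using e0
    have hr : r = 0 := by simpa [p_5_7.ne'] using e5
    subst hu hr
    have ht : t = 0 := by simpa [p_9_9.ne'] using e9
    have hq : q = 0 := by simpa [p_7_4.ne'] using e7
    subst ht hq
    have hp : p = 0 := by simpa [p_2_1.ne'] using e2
    exact ⟨hp, rfl, rfl, rfl, rfl⟩
  have ind2 : ∀ p q r t u : ℝ,
      (∀ i, p * s i 1 + q * s i 4 + r * s i 7 + t * s i 8 + u * s i 5 = 0) →
      p = 0 ∧ q = 0 ∧ r = 0 ∧ t = 0 ∧ u = 0 := by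
    intro p q r t u h
    have e0 := h 0
    have e8 := h 8
    have e9 := h 9
    have e7 := h 7
    have e2 := h 2
    simp only [z_0_1, z_0_4, z_0_7, z_0_9, z_2_0, z_2_2, z_2_4, z_2_5, z_2_8, z_3_0, z_3_2, z_3_4, z_4_1, z_4_3, z_4_7, z_5_1, z_5_3, z_5_4, z_5_9, z_7_1, z_7_3, z_7_5, z_7_7, z_7_9, z_8_0, z_8_1, z_8_4, z_8_8, z_9_1, z_9_2, z_9_4, z_9_7, z_9_8, mul_zero, add_zero, zero_add] at e0 e8 e9 e7 e2
    have hu : u = 0 := by simpa [p_9_5.ne'] using e9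
    subst hu
    have hr : r = 0 := by simpa [p_8_7.ne'] using e8
    have ht : t = 0 := by simpa [p_0_8.ne'] using e0
    subst hr ht
    have hq : q = 0 := by simpa [p_7_4.ne'] using e7
    subst hq
    have hp : p = 0 := by simpa [p_2_1.ne'] using e2
    exact ⟨hp, rfl, rfl, rfl, rfl⟩
  obtain ⟨a1, a4, a7, a9, a3, ha⟩ := exists_comb s hdep 1 4 7 9 3 0 ind1
  obtain ⟨b1, b4, b7, b9, b3, hb⟩ := exists_comb s hdep 1 4 7 9 3 5 ind1
  obtain ⟨c1, c4, c7, c9, c3, hc⟩ := exists_comb s hdep 1 4 7 9 3 8 ind1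
  obtain ⟨q1, q4, q7, q8, q5, hq⟩ := exists_comb s hdep 1 4 7 8 5 0 ind2
  obtain ⟨r1, r4, r7, r8, r5, hr⟩ := exists_comb s hdep 1 4 7 8 5 2 ind2
  have A0 := ha 0
  have A5 := ha 5
  have A8 := ha 8
  have B7 := hb 7
  have B4 := hb 4
  have C0 := hc 0
  have C9 := hc 9
  have Q9 := hq 9
  have Q8 := hq 8
  have Q2 := hq 2
  have Q3 := hq 3
  have R9 := hr 9
  have R8 := hr 8
  have R2 := hr 2
  have R0 := hr 0
  have R3 := hr 3
  simp only [z_0_1, z_0_4, z_0_7, z_0_9, z_2_0, z_2_2, z_2_4, z_2_5, z_2_8, z_3_0, z_3_2, z_3_4, z_4_1, z_4_3, z_4_7, z_5_1, z_5_3, z_5_4, z_5_9, z_7_1, z_7_3, z_7_5, z_7_7, z_7_9, z_8_0, z_8_1, z_8_4, z_8_8, z_9_1, z_9_2, z_9_4, z_9_7, z_9_8, mul_zero, add_zero, zero_add] at A0 A5 A8 B7 B4 C0 C9 Q9 Q8 Q2 Q3 R9 R8 R2 R0 R3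
  have key : a9 - q8 * c9 - q5 * b9 = 0 := by
    refine (ind1 (a1 - q1 - q8 * c1 - q5 * b1) (a4 - q4 - q8 * c4 - q5 * b4)
      (a7 - q7 - q8 * c7 - q5 * b7) (a9 - q8 * c9 - q5 * b9) (a3 - q8 * c3 - q5 * b3) ?_).2.2.2.1
    intro i
    have h1 := ha i
    have h2 := hb i
    have h3 := hc i
    have h4 := hq i
    rw [h2, h3, h1] at h4
    linear_combination h4
  have pos : ∀ {x y z : ℝ}, 0 < y → 0 < z → y = x * z → 0 < x := by
    intro x y z hy hz h
    rw [h] at hy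
    exact pos_of_mul_pos_left hy hz.le
  have neg : ∀ {x y z : ℝ}, 0 < y → 0 < z → x * z + y = 0 → x < 0 := by
    intro x y z hy hz h
    by_contra hx
    have := mul_nonneg (not_lt.1 hx) hz.le
    linarith
  have ha3 : 0 < a3 := pos p_0_0 p_0_3 A0
  have ha7 : 0 < a7 := pos p_5_0 p_5_7 A5
  have ha9 : a9 < 0 := neg (y := a7 * s 8 7 + a3 * s 8 3) (by positivity) p_8_9 (by linarith)
  have hb4 : b4 = 0 := by
    rcases mul_eq_zero.1 B7.symm with h | h
    · exact h
    · exact absurd h p_7_4.ne'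
  subst hb4
  have hb9 : 0 < b9 := pos p_4_5 p_4_9 (by linarith)
  have hc3 : 0 < c3 := pos p_0_8 p_0_3 C0
  have hc9 : c9 < 0 := neg (y := c3 * s 9 3) (by positivity) p_9_9 (by linarith)
  have hq5 : 0 < q5 := pos p_9_0 p_9_5 Q9
  have hq7 : q7 < 0 := neg (y := q5 * s 8 5) (by positivity) p_8_7 (by linarith)
  have hr5 : r5 = 0 := by
    rcases mul_eq_zero.1 R9.symm with h | h
    · exact h
    · exact absurd h p_9_5.ne'
  subst hr5
  have hr7 : 0 < r7 := pos p_8_2 p_8_7 (by linarith)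
  have hr8 : 0 < r8 := pos p_0_2 p_0_8 (by linarith)
  have h1 : r7 * q1 - q7 * r1 = 0 := by
    have : (r7 * q1 - q7 * r1) * s 2 1 = 0 := by linear_combination q7 * R2 - r7 * Q2
    rcases mul_eq_zero.1 this with h | h
    · exact h
    · exact absurd h p_2_1.ne'
  have h8 : r7 * q8 - q7 * r8 < 0 := by
    refine neg (y := r7 * q5 * s 3 5) (by positivity) p_3_8 ?_
    linear_combination q7 * R3 - r7 * Q3 - s 3 1 * h1
  have hm : q7 * r8 < 0 := mul_neg_of_neg_of_pos hq7 hr8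
  have hq8 : q8 < 0 := by
    by_contra hx
    have := mul_nonneg hr7.le (not_lt.1 hx)
    linarith
  have m1 := mul_pos_of_neg_of_neg hq8 hc9
  have m2 := mul_pos hq5 hb9
  linarith

/-- The 3-sphere `(10₍₃₃,₃₅₎)` has no polytopal realization. -/
theorem sphere_10_33_35_12_not_polytopal :
    ¬ ∃ v : Fin 10 → EuclideanSpace ℝ (Fin 4),
      Function.Injective v ∧
      (∀ j, v j ∈ convexHull ℝ (Set.range v) ∧
        v j ∉ convexHull ℝ (convexHull ℝ (Set.range v) \ {v j})) ∧
      {F : Set (EuclideanSpace ℝ (Fin 4)) |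
          F ≠ ∅ ∧ F ≠ convexHull ℝ (Set.range v) ∧
          IsExposed ℝ (convexHull ℝ (Set.range v)) F ∧
          finrank ℝ (vectorSpan ℝ F) = 3} =
        Set.range (fun i : Fin 12 => convexHull ℝ (v '' facets i)) := by
  rintro ⟨v, hinj, hext, hF⟩
  have hne : ∀ i, ∃ j0, j0 ∈ facets i := by
    intro i
    fin_cases i
    exacts [⟨1, by simp [facets]⟩, ⟨2, by simp [facets]⟩, ⟨0, by simp [facets]⟩,
      ⟨0, by simp [facets]⟩, ⟨1, by simp [facets]⟩, ⟨1, by simp [facets]⟩,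
      ⟨0, by simp [facets]⟩, ⟨1, by simp [facets]⟩, ⟨0, by simp [facets]⟩,
      ⟨1, by simp [facets]⟩, ⟨2, by simp [facets]⟩, ⟨0, by simp [facets]⟩]
  have hfun : ∀ i, ∃ (l : EuclideanSpace ℝ (Fin 4) →L[ℝ] ℝ) (c : ℝ),
      (∀ j ∈ facets i, c - l (v j) = 0) ∧ (∀ j, j ∉ facets i → 0 < c - l (v j)) := by
    intro i
    obtain ⟨j0, hj0⟩ := hne i
    have hmem : convexHull ℝ (v '' facets i) ∈
        Set.range (fun i : Fin 12 => convexHull ℝ (v '' facets i)) := ⟨i, rfl⟩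
    rw [← hF] at hmem
    exact facet_functional v hinj hext _ j0 hj0 hmem.2.2.1
  choose l c hz hp using hfun
  refine no_slack (fun i j => c i - l i (v j)) (fun a => ?_) hz hp
  obtain ⟨w, hw0, hw⟩ := exists_dep v a
  exact ⟨w, hw0, fun i => hw (l i) (c i)⟩
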